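/- The facet-adjacency graph G of the 120-cell has 120 vertices, exactly 720 edges, and exactly 600 four-element cliques, and it contains no five-element clique. (These correspond to the 120 facets, 720 pentagonal ridges, and 600 vertices of the 120-cell, with exactly 4 facets meeting at each vertex.) -/

import Mathlib

open Quaternion

noncomputable section

/-- The golden ratio. -/
def gold : ℝ := (1 + Real.sqrt 5) / 2

/-- The coordinates of a quaternion, viewed as a vector in `ℝ⁴`. -/
def qcoords (q : ℍ[ℝ]) : Fin 4 → ℝ := ![q.re, q.imI, q.imJ, q.imK]

/-- The standard inner product of two quaternions viewed as vectors in `ℝ⁴`. -/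
def qinner (p q : ℍ[ℝ]) : ℝ := ∑ i, qcoords p i * qcoords q i

/-- A choice of signs. -/
def IsSign (s : Fin 4 → ℝ) : Prop := ∀ i, s i = 1 ∨ s i = -1

/-- The coordinate multiset `(0, 1, φ⁻¹, φ)`. -/
def baseVec : Fin 4 → ℝ := ![0, 1, gold⁻¹, gold]

/-- The 120 facet centers of the right-angled 120-cell: the 24 Hurwitz units
`±1, ±i, ±j, ±k, (±1±i±j±k)/2` together with the 96 quaternions obtained from
`(0 ± i ± φ⁻¹j ± φk)/2` by even permutations of the coordinates `(0,1,φ⁻¹,φ)`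
and all choices of signs. -/
def Vcell : Set ℍ[ℝ] :=
  {q | (∃ s : Fin 4 → ℝ, IsSign s ∧
          ((∃ i : Fin 4, ∀ j, qcoords q j = if j = i then s i else 0) ∨
           (∀ j, qcoords q j = s j / 2))) ∨
       (∃ σ : Equiv.Perm (Fin 4), σ ∈ alternatingGroup (Fin 4) ∧
          ∃ s : Fin 4 → ℝ, IsSign s ∧ ∀ j, qcoords q j = s j * baseVec (σ j) / 2)}

/-- Facet adjacency in the 120-cell: two facet centers are adjacent iff their
inner product equals `φ/2 = cos (π/5)`. -/
def Adj (p q : ℍ[ℝ]) : Prop := p ∈ Vcell ∧ q ∈ Vcell ∧ qinner p q = gold / 2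

/-- A nonsingular coloring (characteristic function) of the 120-cell: facets get
nonzero colors in `(ℤ/2)⁴` and any four pairwise adjacent facets get a basis. -/
def Nonsingular (lam : ℍ[ℝ] → (Fin 4 → ZMod 2)) : Prop :=
  (∀ q ∈ Vcell, lam q ≠ 0) ∧
  ∀ a b c d : ℍ[ℝ], Adj a b → Adj a c → Adj a d → Adj b c → Adj b d → Adj c d →
    LinearIndependent (ZMod 2) ![lam a, lam b, lam c, lam d]

/-- The symmetry group of the 120-cell, realized as the permutations of `Vcell`
of the form `x ↦ pxq` or `x ↦ p x̄ q` with `p, q ∈ Vcell`. -/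
def SymE : Set (ℍ[ℝ] → ℍ[ℝ]) :=
  {f | ∃ p ∈ Vcell, ∃ q ∈ Vcell,
        (f = fun x => p * x * q) ∨ (f = fun x => p * star x * q)}

/-- DJ-equivalence of colorings: `λ = g ∘ μ ∘ a` on the facets, for some
`g ∈ GL₄(ℤ/2)` and some symmetry `a` of the 120-cell. -/
def DJEquiv (lam mu : ℍ[ℝ] → (Fin 4 → ZMod 2)) : Prop :=
  ∃ g : (Fin 4 → ZMod 2) ≃ₗ[ZMod 2] (Fin 4 → ZMod 2),
    ∃ a ∈ SymE, ∀ x ∈ Vcell, lam x = g (mu (a x))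

/-- Orientability (Nakayama–Nishimura): after a change of basis every color has
odd weight. -/
def OrientableColoring (lam : ℍ[ℝ] → (Fin 4 → ZMod 2)) : Prop :=
  ∃ g : (Fin 4 → ZMod 2) ≃ₗ[ZMod 2] (Fin 4 → ZMod 2),
    ∀ x ∈ Vcell, ∑ i, g (lam x) i = 1


/-- Model of the doubled coordinates: `(a, b)` stands for `(a + b φ)`. -/
abbrev MT : Type := (ℤ × ℤ) × (ℤ × ℤ) × (ℤ × ℤ) × (ℤ × ℤ)

/-- Real value of a pair. -/
def gv (x : ℤ × ℤ) : ℝ := x.1 + x.2 * gold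

/-- The quaternion represented by a model point. -/
def mq (x : MT) : ℍ[ℝ] := ⟨gv x.1 / 2, gv x.2.1 / 2, gv x.2.2.1 / 2, gv x.2.2.2 / 2⟩

theorem gold_sq' : gold * gold = gold + 1 := by
  have := Real.goldenRatio_sq
  rw [sq] at this
  exact this

theorem gold_inv' : gold⁻¹ = gold - 1 := by
  have h := gold_sq'
  have h0 : gold ≠ 0 := by
    intro h0
    rw [h0] at h
    norm_num at h
  field_simp
  linarith

theorem gv_inj {x y : ℤ × ℤ} (h : gv x = gv y) : x = y := by
  have hirr : Irrational gold := Real.goldenRatio_irrational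
  obtain ⟨a, b⟩ := x
  obtain ⟨c, d⟩ := y
  simp only [gv] at h
  have hb : b = d := by
    by_contra hne
    have hne' : ((b - d : ℤ) : ℝ) ≠ 0 := by exact_mod_cast sub_ne_zero.mpr hne
    apply hirr
    refine ⟨((c - a : ℤ) : ℚ) / ((b - d : ℤ) : ℚ), ?_⟩
    push_cast at hne' ⊢
    field_simp
    linarith
  subst hb
  have : (a : ℝ) = c := by linarith
  have : a = c := by exact_mod_cast this
  rw [this]

theorem mq_inj : Function.Injective mq := by
  rintro ⟨a, b, c, d⟩ ⟨a', b', c', d'⟩ h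
  have h1 := congrArg QuaternionAlgebra.re h
  have h2 := congrArg QuaternionAlgebra.imI h
  have h3 := congrArg QuaternionAlgebra.imJ h
  have h4 := congrArg QuaternionAlgebra.imK h
  simp only [mq] at h1 h2 h3 h4
  rw [gv_inj (x := a) (y := a') (by linarith), gv_inj (x := b) (y := b') (by linarith),
    gv_inj (x := c) (y := c') (by linarith), gv_inj (x := d) (y := d') (by linarith)]

/-- Adjacency test in the model. -/
def madj (x y : MT) : Bool :=
  (x.1.1 * y.1.1 + x.1.2 * y.1.2 + (x.2.1.1 * y.2.1.1 + x.2.1.2 * y.2.1.2)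
    + (x.2.2.1.1 * y.2.2.1.1 + x.2.2.1.2 * y.2.2.1.2)
    + (x.2.2.2.1 * y.2.2.2.1 + x.2.2.2.2 * y.2.2.2.2) == 0) &&
  (x.1.1 * y.1.2 + x.1.2 * y.1.1 + x.1.2 * y.1.2
    + (x.2.1.1 * y.2.1.2 + x.2.1.2 * y.2.1.1 + x.2.1.2 * y.2.1.2)
    + (x.2.2.1.1 * y.2.2.1.2 + x.2.2.1.2 * y.2.2.1.1 + x.2.2.1.2 * y.2.2.1.2)
    + (x.2.2.2.1 * y.2.2.2.2 + x.2.2.2.2 * y.2.2.2.1 + x.2.2.2.2 * y.2.2.2.2) == 2)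

theorem gv_mul (a b c d : ℤ) :
    gv (a, b) * gv (c, d) = gv (a * c + b * d, a * d + b * c + b * d) := by
  simp only [gv]
  push_cast
  linear_combination (b * d : ℝ) * gold_sq'

theorem gv_add (a b c d : ℤ) : gv (a, b) + gv (c, d) = gv (a + c, b + d) := by
  simp only [gv]
  push_cast
  ring

theorem madj_iff (x y : MT) : madj x y = true ↔ qinner (mq x) (mq y) = gold / 2 := by
  obtain ⟨⟨a, b⟩, ⟨c, d⟩, ⟨e, f⟩, ⟨g, h⟩⟩ := x
  obtain ⟨⟨a', b'⟩, ⟨c', d'⟩, ⟨e', f'⟩, ⟨g', h'⟩⟩ := y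
  have e1 : ∀ u v : ℤ, gv (u, v) = 2 * gold ↔ u = 0 ∧ v = 2 := by
    intro u v
    constructor
    · intro huv
      have := gv_inj (x := (u, v)) (y := (0, 2)) (by rw [huv]; simp [gv])
      simpa using this
    · rintro ⟨rfl, rfl⟩
      simp [gv]
  have e2 : qinner (mq ((a, b), (c, d), (e, f), (g, h)))
      (mq ((a', b'), (c', d'), (e', f'), (g', h'))) = (gv (a, b) * gv (a', b')
      + gv (c, d) * gv (c', d') + gv (e, f) * gv (e', f') + gv (g, h) * gv (g', h')) / 4 := by
    simp only [qinner, qcoords, mq, Fin.sum_univ_four]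
    simp
    ring
  have e3 : ∀ r : ℝ, r / 4 = gold / 2 ↔ r = 2 * gold := by
    intro r
    constructor <;> intro hr <;> linarith
  rw [e2, e3, gv_mul, gv_mul, gv_mul, gv_mul, gv_add, gv_add, gv_add, e1]
  simp only [madj, Bool.and_eq_true, beq_iff_eq]

/-- Number of `k`-cliques with all members in the list. -/
def cnt {α : Type} (r : α → α → Bool) : ℕ → List α → ℕ
  | 0 => fun _ => 1
  | k + 1 => fun l => List.rec 0 (fun a l ih => cnt r k (l.filter (r a)) + ih) l

theorem cnt_cons {α : Type} (r : α → α → Bool) (k : ℕ) (a : α) (l : List α) :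
    cnt r (k + 1) (a :: l) = cnt r k (l.filter (r a)) + cnt r (k + 1) l := rfl

/-- The `k`-cliques with all members in the image of a list. -/
def cliqs {α β : Type} (f : α → β) (R : β → β → Prop) (k : ℕ) (l : List α) : Set (Finset β) :=
  {s | s.card = k ∧ (∀ x ∈ s, ∃ a ∈ l, f a = x) ∧ ∀ p ∈ s, ∀ q ∈ s, p ≠ q → R p q}

theorem cliqs_finite {α β : Type} (f : α → β) (R : β → β → Prop) (k : ℕ) (l : List α) :
    (cliqs f R k l).Finite := by
  classical
  apply (Finset.finite_toSet ((l.map f).toFinset.powerset)).subset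
  intro s hs
  simp only [Finset.coe_powerset, Set.mem_preimage, Set.mem_powerset_iff]
  intro x hx
  simpa using hs.2.1 x hx

theorem cnt_spec {α β : Type} (f : α → β) (hf : Function.Injective f) (R : β → β → Prop)
    (hR : ∀ p q, R p q → R q p) (r : α → α → Bool)
    (hr : ∀ a b, r a b = true ↔ R (f a) (f b)) :
    ∀ (k : ℕ) (l : List α), l.Nodup → (cliqs f R k l).ncard = cnt r k l := by
  classical
  intro k
  induction k with
  | zero =>
    intro l _
    have : cliqs f R 0 l = {∅} := by
      ext s
      simp only [cliqs, Finset.card_eq_zero, Set.mem_ofPred_eq, Set.mem_singleton_iff]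
      constructor
      · exact fun h => h.1
      · rintro rfl
        simp
    rw [this, Set.ncard_singleton]
    rfl
  | succ k ih1 =>
    intro l
    induction l with
    | nil =>
      intro _
      have : cliqs f R (k + 1) ([] : List α) = ∅ := by
        ext s
        simp only [cliqs, Set.mem_ofPred_eq, Set.mem_empty_iff_false, iff_false]
        rintro ⟨h1, h2, -⟩
        obtain ⟨x, hx⟩ := Finset.card_pos.mp (by omega : 0 < s.card)
        simpa using h2 x hx
      rw [this, Set.ncard_empty]
      rfl
    | cons a l ih2 =>
      intro hnd
      rw [List.nodup_cons] at hnd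
      have hfa : ∀ b ∈ l, f b ≠ f a := by
        intro b hb hba
        exact hnd.1 (hf hba ▸ hb)
      have hn1 : ∀ l' : List α, (∀ b ∈ l', b ∈ l) → ∀ j, ∀ s ∈ cliqs f R j l', f a ∉ s := by
        intro l' hl' j s hs has
        obtain ⟨b, hb, hba⟩ := hs.2.1 _ has
        exact hfa b (hl' b hb) hba
      have hn2 := hn1 (l.filter (r a)) (fun b hb => (List.mem_filter.mp hb).1) k
      have hn3 := hn1 l (fun b hb => hb) (k + 1)
      have key : cliqs f R (k + 1) (a :: l) =
          (insert (f a)) '' cliqs f R k (l.filter (r a)) ∪ cliqs f R (k + 1) l := by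
        ext s
        constructor
        · rintro ⟨h1, h2, h3⟩
          by_cases has : f a ∈ s
          · left
            refine ⟨s.erase (f a), ⟨?_, ?_, ?_⟩, Finset.insert_erase has⟩
            · rw [Finset.card_erase_of_mem has]
              omega
            · intro x hx
              rw [Finset.mem_erase] at hx
              obtain ⟨b, hb, rfl⟩ := h2 x hx.2
              refine ⟨b, ?_, rfl⟩
              rw [List.mem_filter]
              constructor
              · rcases List.mem_cons.mp hb with rfl | hb
                · exact absurd rfl hx.1
                · exact hb
              · exact (hr a b).mpr (h3 _ has _ hx.2 hx.1.symm)
            · intro p hp q hq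
              exact h3 p (Finset.mem_of_mem_erase hp) q (Finset.mem_of_mem_erase hq)
          · right
            refine ⟨h1, ?_, h3⟩
            intro x hx
            obtain ⟨b, hb, rfl⟩ := h2 x hx
            rcases List.mem_cons.mp hb with rfl | hb
            · exact absurd hx has
            · exact ⟨b, hb, rfl⟩
        · rintro (⟨t, ht, rfl⟩ | ⟨h1, h2, h3⟩)
          · have hat := hn2 t ht
            obtain ⟨h1, h2, h3⟩ := ht
            have hadj : ∀ x ∈ t, R (f a) x := by
              intro x hx
              obtain ⟨b, hb, rfl⟩ := h2 x hx
              exact (hr a b).mp (List.mem_filter.mp hb).2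
            refine ⟨?_, ?_, ?_⟩
            · rw [Finset.card_insert_of_notMem hat, h1]
            · intro x hx
              rcases Finset.mem_insert.mp hx with rfl | hx
              · exact ⟨a, by simp, rfl⟩
              · obtain ⟨b, hb, rfl⟩ := h2 x hx
                exact ⟨b, List.mem_cons_of_mem _ (List.mem_filter.mp hb).1, rfl⟩
            · intro p hp q hq hpq
              rcases Finset.mem_insert.mp hp with rfl | hp
              · rcases Finset.mem_insert.mp hq with rfl | hq
                · exact absurd rfl hpq
                · exact hadj q hq
              · rcases Finset.mem_insert.mp hq with rfl | hq
                · exact hR _ _ (hadj p hp)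
                · exact h3 p hp q hq hpq
          · refine ⟨h1, ?_, h3⟩
            intro x hx
            obtain ⟨b, hb, rfl⟩ := h2 x hx
            exact ⟨b, List.mem_cons_of_mem _ hb, rfl⟩
      rw [key, Set.ncard_union_eq ?_ ((cliqs_finite ..).image _) (cliqs_finite ..),
        Set.ncard_image_of_injOn, ih1 _ (hnd.2.filter _), ih2 hnd.2, cnt_cons]
      · intro s hs t ht hst
        have := congrArg (fun u => Finset.erase u (f a)) hst
        simpa [Finset.erase_insert (hn2 s hs), Finset.erase_insert (hn2 t ht)] using this
      · rw [Set.disjoint_left]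
        rintro s ⟨t, -, rfl⟩ hs
        exact hn3 _ hs (Finset.mem_insert_self _ _)

/-- A sign. -/
def sg (b : Bool) : ℤ := if b then 1 else -1

/-- A signed pair. -/
def sm (b : Bool) (x : ℤ × ℤ) : ℤ × ℤ := if b then x else (-x.1, -x.2)

/-- Model of `(0, 1, φ⁻¹, φ)`. -/
def mbase : Fin 4 → ℤ × ℤ := ![(0, 0), (1, 0), (-1, 1), (0, 1)]

/-- Model of a signed vector. -/
def menc (v : Fin 4 → ℤ × ℤ) (a b c d : Bool) : MT :=
  (sm a (v 0), sm b (v 1), sm c (v 2), sm d (v 3))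

/-- Model of the unit vectors (doubled). -/
def munit (i : Fin 4) : Fin 4 → ℤ × ℤ := fun j => if j = i then (2, 0) else (0, 0)

/-- Both signs of a pair, without repetition. -/
def pm (x : ℤ × ℤ) : List (ℤ × ℤ) := if x = (0, 0) then [x] else [x, (-x.1, -x.2)]

/-- All signed versions of a vector. -/
def allpm (x y z w : ℤ × ℤ) : List MT :=
  (pm x).flatMap fun a => (pm y).flatMap fun b => (pm z).flatMap fun c =>
    (pm w).map fun d => (a, b, c, d)

/-- Cyclic permutations of the last three coordinates. -/
def cyc (x y z w : ℤ × ℤ) : List MT := allpm x y z w ++ allpm x z w y ++ allpm x w y z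

/-- All the vertices in the model. -/
def mlist : List MT :=
  allpm (2, 0) (0, 0) (0, 0) (0, 0) ++ cyc (0, 0) (2, 0) (0, 0) (0, 0) ++
  allpm (1, 0) (1, 0) (1, 0) (1, 0) ++
  cyc (0, 0) (1, 0) (-1, 1) (0, 1) ++ cyc (1, 0) (0, 0) (0, 1) (-1, 1) ++
  cyc (-1, 1) (0, 0) (1, 0) (0, 1) ++ cyc (0, 1) (0, 0) (-1, 1) (1, 0)

theorem mlist_length : mlist.length = 120 := by decide +kernel
theorem mlist_nodup : mlist.Nodup := by decide +kernel
theorem cnt_two : cnt madj 2 mlist = 720 := by decide +kernel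
theorem cnt_four : cnt madj 4 mlist = 600 := by decide +kernel
theorem cnt_five : cnt madj 5 mlist = 0 := by decide +kernel

theorem mem1 : ∀ i a b c d, menc (munit i) a b c d ∈ mlist := by decide +kernel
theorem mem2 : ∀ a b c d, menc (fun _ => (1, 0)) a b c d ∈ mlist := by decide +kernel
theorem mem3 : ∀ σ : Equiv.Perm (Fin 4), Equiv.Perm.sign σ = 1 →
    ∀ a b c d, menc (fun j => mbase (σ j)) a b c d ∈ mlist := by decide +kernel

theorem mem_cases : ∀ x ∈ mlist, (∃ i a b c d, x = menc (munit i) a b c d) ∨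
    (∃ a b c d, x = menc (fun _ => (1, 0)) a b c d) ∨
    ∃ σ : Equiv.Perm (Fin 4), Equiv.Perm.sign σ = 1 ∧
      ∃ a b c d, x = menc (fun j => mbase (σ j)) a b c d := by decide +kernel

theorem gv_sm (b : Bool) (x : ℤ × ℤ) : gv (sm b x) = (sg b : ℝ) * gv x := by
  cases b <;> simp [sm, sg, gv]
  ring

theorem qcoords_inj {p q : ℍ[ℝ]} (h : ∀ j, qcoords p j = qcoords q j) : p = q := by
  have h0 := h 0
  have h1 := h 1
  have h2 := h 2
  have h3 := h 3
  simp [qcoords] at h0 h1 h2 h3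
  ext <;> assumption

theorem qcoords_menc (v : Fin 4 → ℤ × ℤ) (t : Fin 4 → Bool) (j : Fin 4) :
    qcoords (mq (menc v (t 0) (t 1) (t 2) (t 3))) j = (sg (t j) : ℝ) * gv (v j) / 2 := by
  fin_cases j <;> simp [qcoords, mq, menc, gv_sm]

theorem sign_bool {s : Fin 4 → ℝ} (hs : IsSign s) : ∃ t : Fin 4 → Bool, ∀ j, s j = sg (t j) := by
  have : ∀ j, ∃ b : Bool, s j = sg b := by
    intro j
    rcases hs j with h | h
    · exact ⟨true, by simp [h, sg]⟩
    · exact ⟨false, by simp [h, sg]⟩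
  choose t ht using this
  exact ⟨t, ht⟩

theorem isSign_sg (t : Fin 4 → Bool) : IsSign fun j => (sg (t j) : ℝ) := by
  intro j
  cases h : t j <;> simp [sg, h]

theorem gv_mbase (j : Fin 4) : gv (mbase j) = baseVec j := by
  fin_cases j <;> simp [gv, mbase, baseVec, gold_inv']
  ring

theorem gv_munit (i j : Fin 4) (s : ℝ) (t : Fin 4 → ℝ) (h : s = t j) :
    s * gv (munit i j) / 2 = if j = i then t i else 0 := by
  by_cases hj : j = i
  · subst hj
    simp [munit, gv, h]
  · simp [munit, gv, hj]

theorem mem_Vcell (q : ℍ[ℝ]) : q ∈ Vcell ↔ ∃ x ∈ mlist, mq x = q := by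
  constructor
  · rintro (⟨s, hs, ⟨i, hi⟩ | hi⟩ | ⟨σ, hσ, s, hs, hi⟩)
    · obtain ⟨t, ht⟩ := sign_bool hs
      refine ⟨_, mem1 i (t 0) (t 1) (t 2) (t 3), qcoords_inj fun j => ?_⟩
      rw [qcoords_menc, hi, gv_munit i j _ s (ht j).symm]
    · obtain ⟨t, ht⟩ := sign_bool hs
      refine ⟨_, mem2 (t 0) (t 1) (t 2) (t 3), qcoords_inj fun j => ?_⟩
      rw [qcoords_menc, hi, ht]
      simp [gv]
    · obtain ⟨t, ht⟩ := sign_bool hs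
      refine ⟨_, mem3 σ (Equiv.Perm.mem_alternatingGroup.mp hσ) (t 0) (t 1) (t 2) (t 3),
        qcoords_inj fun j => ?_⟩
      rw [qcoords_menc, hi, ht, gv_mbase]
  · rintro ⟨x, hx, rfl⟩
    rcases mem_cases x hx with ⟨i, a, b, c, d, rfl⟩ | ⟨a, b, c, d, rfl⟩ | ⟨σ, hσ, a, b, c, d, rfl⟩
    · refine Or.inl ⟨_, isSign_sg ![a, b, c, d], Or.inl ⟨i, fun j => ?_⟩⟩
      exact (qcoords_menc _ ![a, b, c, d] j).trans
        (gv_munit i j _ (fun j => (sg (![a, b, c, d] j) : ℝ)) rfl)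
    · refine Or.inl ⟨_, isSign_sg ![a, b, c, d], Or.inr fun j => ?_⟩
      refine (qcoords_menc _ ![a, b, c, d] j).trans ?_
      simp [gv]
    · refine Or.inr ⟨σ, Equiv.Perm.mem_alternatingGroup.mpr hσ, _, isSign_sg ![a, b, c, d],
        fun j => ?_⟩
      refine (qcoords_menc _ ![a, b, c, d] j).trans ?_
      rw [gv_mbase]

theorem cliq_eq (k : ℕ) (hk : 2 ≤ k) :
    {s : Finset ℍ[ℝ] | s.card = k ∧ ∀ p ∈ s, ∀ q ∈ s, p ≠ q → Adj p q} =
      cliqs mq (fun p q => qinner p q = gold / 2) k mlist := by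
  ext s
  constructor
  · rintro ⟨h1, h2⟩
    refine ⟨h1, fun x hx => ?_, fun p hp q hq hpq => (h2 p hp q hq hpq).2.2⟩
    obtain ⟨y, hy, hyx⟩ := Finset.exists_mem_ne (by omega : 1 < s.card) x
    exact (mem_Vcell x).mp (h2 x hx y hy hyx.symm).1
  · rintro ⟨h1, h2, h3⟩
    exact ⟨h1, fun p hp q hq hpq =>
      ⟨(mem_Vcell p).mpr (h2 p hp), (mem_Vcell q).mpr (h2 q hq), h3 p hp q hq hpq⟩⟩

theorem cliq_count (k : ℕ) (hk : 2 ≤ k) :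
    {s : Finset ℍ[ℝ] | s.card = k ∧ ∀ p ∈ s, ∀ q ∈ s, p ≠ q → Adj p q}.ncard =
      cnt madj k mlist := by
  rw [cliq_eq k hk]
  refine cnt_spec mq mq_inj _ ?_ madj madj_iff k mlist mlist_nodup
  intro p q h
  rw [← h]
  simp only [qinner, mul_comm]

/-- The facet-adjacency graph of the 120-cell has 120 vertices, 720 edges and
600 four-element cliques, and no five-element clique. -/
theorem facet_graph_counts :
    Set.ncard Vcell = 120 ∧
    Set.ncard {s : Finset ℍ[ℝ] |
      s.card = 2 ∧ ∀ p ∈ s, ∀ q ∈ s, p ≠ q → Adj p q} = 720 ∧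
    Set.ncard {s : Finset ℍ[ℝ] |
      s.card = 4 ∧ ∀ p ∈ s, ∀ q ∈ s, p ≠ q → Adj p q} = 600 ∧
    ¬ ∃ s : Finset ℍ[ℝ],
      s.card = 5 ∧ ∀ p ∈ s, ∀ q ∈ s, p ≠ q → Adj p q := by
  refine ⟨?_, ?_, ?_, ?_⟩
  · classical
    have h : Vcell = mq '' (mlist.toFinset : Set MT) := by
      ext q
      rw [mem_Vcell]
      simp
    rw [h, Set.ncard_image_of_injective _ mq_inj, Set.ncard_coe_finset,
      List.toFinset_card_of_nodup mlist_nodup, mlist_length]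
  · rw [cliq_count 2 (by norm_num), cnt_two]
  · rw [cliq_count 4 (by norm_num), cnt_four]
  · rintro ⟨s, hs⟩
    have h := cliq_count 5 (by norm_num)
    rw [cnt_five, Set.ncard_eq_zero (by rw [cliq_eq 5 (by norm_num)]; exact cliqs_finite ..)] at h
    exact Set.eq_empty_iff_forall_notMem.mp h s hs
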